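/- Let χ ∈ L¹_loc(ℝⁿ) be (0,L)ⁿ-periodic with 0 ≤ χ ≤ 1, let 0 < ℓ ≤ r, and let ψ(x) := (1/|B_r|)∫_{B_r(x)} min{(2r/ℓ)ⁿ χ_{2r}(y), 1} dy, where χ_{2r} is the average of χ over balls of radius 2r. Then ψ is Lipschitz with |ψ(x) - ψ(x+z)| ≤ c_n |z|/r for a dimensional constant c_n, and ∫_{(0,L)ⁿ} |ψ(x) - ψ(x+z)| dx ≤ C_n (|z|/r)(2r/ℓ)ⁿ ∫_{(0,L)ⁿ} χ dx. -/

import Mathlib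

open MeasureTheory Set Metric

/-- Average of `f` over the ball of radius `s` centered at `x`. -/
noncomputable def ballAvg {n : ℕ} (f : EuclideanSpace ℝ (Fin n) → ℝ) (s : ℝ)
    (x : EuclideanSpace ℝ (Fin n)) : ℝ :=
  ⨍ y in ball x s, f y

/-- The concentration test function built from `χ` (with `M = 1`). -/
noncomputable def psiFn {n : ℕ} (χ : EuclideanSpace ℝ (Fin n) → ℝ) (ℓ r : ℝ)
    (x : EuclideanSpace ℝ (Fin n)) : ℝ :=
  ⨍ y in ball x r, min ((2 * r / ℓ) ^ n * ballAvg χ (2 * r) y) 1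

open scoped Pointwise

lemma abs_setIntegral_sub_le_setIntegral_symmDiff {α : Type*} [MeasurableSpace α] {μ : Measure α}
    {A B : Set α} {h : α → ℝ} (hA : MeasurableSet A) (hB : MeasurableSet B)
    (hhA : IntegrableOn h A μ) (hhB : IntegrableOn h B μ) (h0 : ∀ x, 0 ≤ h x) :
    |(∫ x in A, h x ∂μ) - ∫ x in B, h x ∂μ| ≤ ∫ x in symmDiff A B, h x ∂μ := by
  have hdA := integral_inter_add_sdiff hB hhA
  have hdB := integral_inter_add_sdiff hA hhB
  rw [inter_comm] at hdB
  have hU : ∫ x in symmDiff A B, h x ∂μ = (∫ x in A \ B, h x ∂μ) + ∫ x in B \ A, h x ∂μ :=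
    setIntegral_union (disjoint_sdiff_sdiff) (hB.diff hA)
      (hhA.mono_set sdiff_subset) (hhB.mono_set sdiff_subset)
  have hAB : 0 ≤ ∫ x in A \ B, h x ∂μ := integral_nonneg h0
  have hBA : 0 ≤ ∫ x in B \ A, h x ∂μ := integral_nonneg h0
  rw [hU, abs_le]
  constructor <;> linarith

section

variable {n : ℕ}

lemma volume_real_ball_eq (x : EuclideanSpace ℝ (Fin n)) {r : ℝ} (hr : 0 < r) :
    volume.real (ball x r) = r ^ n * volume.real (ball (0 : EuclideanSpace ℝ (Fin n)) 1) := by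
  rw [measureReal_def, Measure.addHaar_ball_of_pos volume x hr, ENNReal.toReal_mul,
    ENNReal.toReal_ofReal (by positivity), finrank_euclideanSpace_fin, measureReal_def]

lemma volume_real_ball_pos (x : EuclideanSpace ℝ (Fin n)) {r : ℝ} (hr : 0 < r) :
    0 < volume.real (ball x r) :=
  ENNReal.toReal_pos (measure_ball_pos volume x hr).ne' measure_ball_lt_top.ne

lemma volume_real_ball_diff_ball_le (x y : EuclideanSpace ℝ (Fin n)) {r : ℝ} (hr : 0 < r) :
    volume.real (ball x r \ ball y r) ≤ (n + 1) * (dist x y / r) * volume.real (ball x r) := by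
  have hV := volume_real_ball_pos x hr
  rcases le_or_gt r (dist x y) with hd | hd
  · calc volume.real (ball x r \ ball y r) ≤ 1 * 1 * volume.real (ball x r) := by
          rw [one_mul, one_mul]
          exact measureReal_mono sdiff_subset measure_ball_lt_top.ne
      _ ≤ _ := by
          gcongr
          · linarith [(Nat.cast_nonneg n : (0 : ℝ) ≤ n)]
          · rwa [one_le_div hr]
  · have hsub : ball x (r - dist x y) ⊆ ball y r := ball_subset_ball' (by linarith)
    have hsub' : ball x (r - dist x y) ⊆ ball x r :=
      ball_subset_ball (by linarith [dist_nonneg (x := x) (y := y)])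
    have hpow : 1 + (n : ℝ) * (-(dist x y / r)) ≤ (1 + -(dist x y / r)) ^ n := by
      apply one_add_mul_le_pow
      have : dist x y / r < 1 := by rwa [div_lt_one hr]
      linarith
    have hball : volume.real (ball x (r - dist x y))
        = (1 + -(dist x y / r)) ^ n * volume.real (ball x r) := by
      rw [volume_real_ball_eq x hr, volume_real_ball_eq x (sub_pos.2 hd), ← mul_assoc, ← mul_pow]
      congr 2
      field_simp
      ring
    calc volume.real (ball x r \ ball y r)
        ≤ volume.real (ball x r \ ball x (r - dist x y)) :=
          measureReal_mono (sdiff_subset_sdiff_right hsub)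
            (measure_ne_top_of_subset sdiff_subset measure_ball_lt_top.ne)
      _ = volume.real (ball x r) - volume.real (ball x (r - dist x y)) :=
          measureReal_sdiff hsub' measurableSet_ball measure_ball_lt_top.ne
      _ ≤ (n + 1) * (dist x y / r) * volume.real (ball x r) := by
          rw [hball]
          have : 0 ≤ dist x y / r := by positivity
          nlinarith

lemma volume_real_symmDiff_ball_le (z : EuclideanSpace ℝ (Fin n)) {r : ℝ} (hr : 0 < r) :
    volume.real (symmDiff (ball 0 r) (ball z r))
      ≤ 2 * (n + 1) * (‖z‖ / r) * volume.real (ball (0 : EuclideanSpace ℝ (Fin n)) r) := by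
  have h1 := volume_real_ball_diff_ball_le 0 z hr
  have h2 := volume_real_ball_diff_ball_le z 0 hr
  rw [dist_zero_left] at h1
  rw [dist_zero_right, Measure.addHaar_real_ball_center volume z r] at h2
  have h3 : volume.real (symmDiff (ball 0 r) (ball z r))
      ≤ volume.real (ball 0 r \ ball z r) + volume.real (ball z r \ ball 0 r) :=
    measureReal_union_le _ _
  linarith

lemma measure_symmDiff_ball_lt_top (z : EuclideanSpace ℝ (Fin n)) (r : ℝ) :
    volume (symmDiff (ball 0 r) (ball z r)) < ⊤ :=
  measure_lt_top_of_subset symmDiff_subset_union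
    (measure_union_lt_top measure_ball_lt_top measure_ball_lt_top).ne

lemma setIntegral_ball_eq_translate (f : EuclideanSpace ℝ (Fin n) → ℝ)
    (x z : EuclideanSpace ℝ (Fin n)) (r : ℝ) :
    ∫ y in ball (x + z) r, f y = ∫ w in ball z r, f (x + w) := by
  rw [← (measurePreserving_add_left volume x).setIntegral_preimage_emb
    (measurableEmbedding_addLeft x), preimage_add_ball, add_sub_cancel_left]

lemma ballAvg_eq (f : EuclideanSpace ℝ (Fin n) → ℝ) (r : ℝ) (x : EuclideanSpace ℝ (Fin n)) :
    ballAvg f r x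
      = (volume.real (ball (0 : EuclideanSpace ℝ (Fin n)) r))⁻¹ * ∫ w in ball 0 r, f (x + w) := by
  rw [ballAvg, setAverage_eq, Measure.addHaar_real_ball_center, smul_eq_mul]
  congr 1
  simpa using setIntegral_ball_eq_translate f x 0 r

lemma integrableOn_translate {f : EuclideanSpace ℝ (Fin n) → ℝ}
    (hf : AEStronglyMeasurable f volume) (h0 : ∀ x, 0 ≤ f x) (h1 : ∀ x, f x ≤ 1)
    (x : EuclideanSpace ℝ (Fin n)) {A : Set (EuclideanSpace ℝ (Fin n))} (hA : volume A < ⊤) :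
    IntegrableOn (fun w => f (x + w)) A :=
  Measure.integrableOn_of_bounded (M := 1) hA.ne
    (hf.comp_measurePreserving (measurePreserving_add_left volume x))
    (Filter.Eventually.of_forall fun w => by
      rw [Real.norm_eq_abs, abs_of_nonneg (h0 _)]; exact h1 _)

lemma abs_ballAvg_sub_le {f : EuclideanSpace ℝ (Fin n) → ℝ}
    (hf : AEStronglyMeasurable f volume) (h0 : ∀ x, 0 ≤ f x) (h1 : ∀ x, f x ≤ 1) (r : ℝ)
    (x z : EuclideanSpace ℝ (Fin n)) :
    |ballAvg f r x - ballAvg f r (x + z)|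
      ≤ (volume.real (ball (0 : EuclideanSpace ℝ (Fin n)) r))⁻¹ *
        ∫ w in symmDiff (ball 0 r) (ball z r), f (x + w) := by
  have hz : ballAvg f r (x + z)
      = (volume.real (ball (0 : EuclideanSpace ℝ (Fin n)) r))⁻¹ * ∫ w in ball z r, f (x + w) := by
    rw [ballAvg, setAverage_eq, Measure.addHaar_real_ball_center, smul_eq_mul,
      setIntegral_ball_eq_translate]
  rw [hz, ballAvg_eq, ← mul_sub, abs_mul, abs_of_nonneg (inv_nonneg.2 measureReal_nonneg)]
  gcongr
  exact abs_setIntegral_sub_le_setIntegral_symmDiff measurableSet_ball measurableSet_ball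
    (integrableOn_translate hf h0 h1 x measure_ball_lt_top)
    (integrableOn_translate hf h0 h1 x measure_ball_lt_top) fun w => h0 _

lemma abs_ballAvg_sub_le_norm {f : EuclideanSpace ℝ (Fin n) → ℝ}
    (hf : AEStronglyMeasurable f volume) (h0 : ∀ x, 0 ≤ f x) (h1 : ∀ x, f x ≤ 1) {r : ℝ}
    (hr : 0 < r) (x z : EuclideanSpace ℝ (Fin n)) :
    |ballAvg f r x - ballAvg f r (x + z)| ≤ 2 * (n + 1) * ‖z‖ / r := by
  have hV := volume_real_ball_pos (0 : EuclideanSpace ℝ (Fin n)) hr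
  have hint : ∫ w in symmDiff (ball 0 r) (ball z r), f (x + w)
      ≤ volume.real (symmDiff (ball 0 r) (ball z r)) := by
    calc _ ≤ ∫ w in symmDiff (ball 0 r) (ball z r), (1 : ℝ) :=
          integral_mono
            (integrableOn_translate hf h0 h1 x (measure_symmDiff_ball_lt_top z r))
            (integrableOn_const (measure_symmDiff_ball_lt_top z r).ne) fun w => h1 _
      _ = _ := by simp
  calc _ ≤ _ := abs_ballAvg_sub_le hf h0 h1 r x z
    _ ≤ (volume.real (ball (0 : EuclideanSpace ℝ (Fin n)) r))⁻¹ *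
        (2 * (n + 1) * (‖z‖ / r) * volume.real (ball (0 : EuclideanSpace ℝ (Fin n)) r)) := by
        gcongr
        exact hint.trans (volume_real_symmDiff_ball_le z hr)
    _ = _ := by field_simp

lemma continuous_ballAvg {f : EuclideanSpace ℝ (Fin n) → ℝ}
    (hf : AEStronglyMeasurable f volume) (h0 : ∀ x, 0 ≤ f x) (h1 : ∀ x, f x ≤ 1) {r : ℝ}
    (hr : 0 < r) : Continuous (ballAvg f r) := by
  refine (LipschitzWith.of_dist_le' (K := 2 * (n + 1) / r) fun x y => ?_).continuous
  have h := abs_ballAvg_sub_le_norm hf h0 h1 hr x (y - x)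
  rw [add_sub_cancel, ← dist_eq_norm, dist_comm y x] at h
  rw [Real.dist_eq]
  exact h.trans_eq (by ring)

lemma ballAvg_nonneg {f : EuclideanSpace ℝ (Fin n) → ℝ} (h0 : ∀ x, 0 ≤ f x) (r : ℝ)
    (x : EuclideanSpace ℝ (Fin n)) : 0 ≤ ballAvg f r x := by
  rw [ballAvg_eq]
  exact mul_nonneg (inv_nonneg.2 measureReal_nonneg) (integral_nonneg fun w => h0 _)

/-- The open cube `(0, L)ⁿ`. -/
def openCube (n : ℕ) (L : ℝ) : Set (EuclideanSpace ℝ (Fin n)) :=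
  {x | ∀ i, x i ∈ Ioo (0 : ℝ) L}

/-- The standard basis of `ℝⁿ` scaled by `L`. -/
noncomputable def scaledBasis (n : ℕ) {L : ℝ} (hL : 0 < L) :
    Module.Basis (Fin n) ℝ (EuclideanSpace ℝ (Fin n)) :=
  (EuclideanSpace.basisFun (Fin n) ℝ).toBasis.isUnitSMul (w := fun _ => L) fun _ => hL.ne'.isUnit

lemma scaledBasis_repr {L : ℝ} (hL : 0 < L) (x : EuclideanSpace ℝ (Fin n)) (i : Fin n) :
    (scaledBasis n hL).repr x i = L⁻¹ * x i := by
  rw [scaledBasis, Module.Basis.repr_isUnitSMul]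
  simp [Units.smul_def]

lemma openCube_ae_eq_fundamentalDomain {L : ℝ} (hL : 0 < L) :
    openCube n L =ᵐ[volume] ZSpan.fundamentalDomain (scaledBasis n hL) := by
  have h : ZSpan.fundamentalDomain (scaledBasis n hL)
      = (MeasurableEquiv.toLp 2 (Fin n → ℝ)).symm ⁻¹' (univ.pi fun _ => Ico 0 L) := by
    ext x
    simp only [ZSpan.mem_fundamentalDomain, scaledBasis_repr, mem_preimage, mem_univ_pi]
    refine forall_congr' fun i => ?_
    change L⁻¹ * x i ∈ Ico (0 : ℝ) 1 ↔ x i ∈ Ico 0 L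
    rw [mem_Ico, mem_Ico, inv_mul_eq_div, div_lt_one hL, le_div_iff₀ hL, zero_mul]
  have h' : openCube n L
      = (MeasurableEquiv.toLp 2 (Fin n → ℝ)).symm ⁻¹' (univ.pi fun _ => Ioo 0 L) := by
    ext x
    simp only [mem_preimage, mem_univ_pi]
    rfl
  rw [h, h']
  exact (EuclideanSpace.volume_preserving_symm_measurableEquiv_toLp
    (Fin n)).quasiMeasurePreserving.preimage_ae_eq
      (Measure.pi_Ioo_ae_eq_pi_Icc.trans Measure.pi_Ico_ae_eq_pi_Icc.symm)

/-- `f` is periodic with respect to the lattice `L ℤⁿ`. -/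
def CubePeriodic (L : ℝ) (f : EuclideanSpace ℝ (Fin n) → ℝ) : Prop :=
  ∀ (k : Fin n → ℤ) (x : EuclideanSpace ℝ (Fin n)),
    f (x + (EuclideanSpace.equiv (Fin n) ℝ).symm (fun i => L * (k i : ℝ))) = f x

lemma CubePeriodic.add_mem_span {L : ℝ} {f : EuclideanSpace ℝ (Fin n) → ℝ}
    (hf : CubePeriodic L f) (hL : 0 < L) {v : EuclideanSpace ℝ (Fin n)}
    (hv : v ∈ Submodule.span ℤ (range (scaledBasis n hL))) (x : EuclideanSpace ℝ (Fin n)) :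
    f (v + x) = f x := by
  rw [Module.Basis.mem_span_iff_repr_mem] at hv
  choose k hk using hv
  have hvk : v = (EuclideanSpace.equiv (Fin n) ℝ).symm (fun i => L * (k i : ℝ)) := by
    ext i
    have := hk i
    rw [scaledBasis_repr] at this
    simp only [algebraMap_int_eq, eq_intCast] at this
    change v i = L * (k i : ℝ)
    rw [this]
    field_simp
  rw [add_comm, hvk, hf]

lemma CubePeriodic.setIntegral_translate {L : ℝ} {f : EuclideanSpace ℝ (Fin n) → ℝ}
    (hf : CubePeriodic L f) (hL : 0 < L) (w : EuclideanSpace ℝ (Fin n)) :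
    ∫ x in openCube n L, f (x + w) = ∫ x in openCube n L, f x := by
  rw [setIntegral_congr_set (openCube_ae_eq_fundamentalDomain hL),
    setIntegral_congr_set (openCube_ae_eq_fundamentalDomain hL)]
  have hD := ZSpan.isAddFundamentalDomain (scaledBasis n hL) volume
  have hD' := hD.vadd_of_comm w
  have : VAddInvariantMeasure (Submodule.span ℤ (range (scaledBasis n hL)))
      (EuclideanSpace ℝ (Fin n)) volume := inferInstanceAs <|
    VAddInvariantMeasure (Submodule.span ℤ (range (scaledBasis n hL))).toAddSubgroup _ _
  have hpre : (· + w) ⁻¹' (w +ᵥ ZSpan.fundamentalDomain (scaledBasis n hL))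
      = ZSpan.fundamentalDomain (scaledBasis n hL) := by
    ext x
    rw [mem_preimage, add_comm, ← vadd_eq_add, vadd_mem_vadd_set_iff]
  have htr := (measurePreserving_add_right volume w).setIntegral_preimage_emb
    (measurableEmbedding_addRight w) f (w +ᵥ ZSpan.fundamentalDomain (scaledBasis n hL))
  rw [hpre] at htr
  rw [htr, hD.setIntegral_eq hD' fun v x => hf.add_mem_span hL v.2 x]

lemma CubePeriodic.ballAvg {L : ℝ} {f : EuclideanSpace ℝ (Fin n) → ℝ}
    (hf : CubePeriodic L f) (r : ℝ) : CubePeriodic L (ballAvg f r) := by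
  intro k x
  simp only [ballAvg_eq]
  congr 2
  ext w
  rw [add_right_comm, hf]

lemma volume_openCube_lt_top {L : ℝ} (hL : 0 < L) : volume (openCube n L) < ⊤ := by
  rw [measure_congr (openCube_ae_eq_fundamentalDomain hL)]
  exact (ZSpan.fundamentalDomain_isBounded _).measure_lt_top

lemma CubePeriodic.setIntegral_setIntegral_translate {L : ℝ} {f : EuclideanSpace ℝ (Fin n) → ℝ}
    (hp : CubePeriodic L f) (hL : 0 < L) (hf : AEStronglyMeasurable f volume)
    (h0 : ∀ x, 0 ≤ f x) (h1 : ∀ x, f x ≤ 1) {A : Set (EuclideanSpace ℝ (Fin n))}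
    (hA : volume A < ⊤) :
    IntegrableOn (fun x => ∫ w in A, f (x + w)) (openCube n L) ∧
    ∫ x in openCube n L, ∫ w in A, f (x + w) = volume.real A * ∫ x in openCube n L, f x := by
  have : IsFiniteMeasure (volume.restrict A) := ⟨by simpa using hA⟩
  have : IsFiniteMeasure (volume.restrict (openCube n L)) :=
    ⟨by simpa using volume_openCube_lt_top hL⟩
  have hm : AEStronglyMeasurable (fun p : EuclideanSpace ℝ (Fin n) × EuclideanSpace ℝ (Fin n) =>
      f (p.1 + p.2)) (volume.prod volume) :=
    hf.comp_snd.comp_measurePreserving (measurePreserving_prod_add volume volume)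
  have hint : Integrable (fun p : EuclideanSpace ℝ (Fin n) × EuclideanSpace ℝ (Fin n) =>
      f (p.1 + p.2)) ((volume.restrict (openCube n L)).prod (volume.restrict A)) := by
    refine Integrable.of_bound ?_ 1 (Filter.Eventually.of_forall fun p => ?_)
    · rw [Measure.prod_restrict]
      exact hm.restrict
    · rw [Real.norm_eq_abs, abs_of_nonneg (h0 _)]
      exact h1 _
  refine ⟨hint.integral_prod_left, ?_⟩
  rw [integral_integral_swap hint]
  simp [hp.setIntegral_translate hL]

lemma CubePeriodic.setIntegral_ballAvg {L : ℝ} {f : EuclideanSpace ℝ (Fin n) → ℝ}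
    (hp : CubePeriodic L f) (hL : 0 < L) (hf : AEStronglyMeasurable f volume)
    (h0 : ∀ x, 0 ≤ f x) (h1 : ∀ x, f x ≤ 1) {r : ℝ} (hr : 0 < r) :
    ∫ x in openCube n L, _root_.ballAvg f r x = ∫ x in openCube n L, f x := by
  simp only [ballAvg_eq]
  rw [integral_const_mul, (hp.setIntegral_setIntegral_translate hL hf h0 h1
    measure_ball_lt_top).2, inv_mul_cancel_left₀ (volume_real_ball_pos 0 hr).ne']

lemma CubePeriodic.setIntegral_abs_ballAvg_sub_le {L : ℝ} {f : EuclideanSpace ℝ (Fin n) → ℝ}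
    (hp : CubePeriodic L f) (hL : 0 < L) (hf : AEStronglyMeasurable f volume)
    (h0 : ∀ x, 0 ≤ f x) (h1 : ∀ x, f x ≤ 1) {r : ℝ} (hr : 0 < r)
    (z : EuclideanSpace ℝ (Fin n)) :
    ∫ x in openCube n L, |_root_.ballAvg f r x - _root_.ballAvg f r (x + z)|
      ≤ 2 * (n + 1) * (‖z‖ / r) * ∫ x in openCube n L, f x := by
  have hV := volume_real_ball_pos (0 : EuclideanSpace ℝ (Fin n)) hr
  obtain ⟨hint, heq⟩ := hp.setIntegral_setIntegral_translate hL hf h0 h1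
    (measure_symmDiff_ball_lt_top z r)
  calc _ ≤ ∫ x in openCube n L, (volume.real (ball (0 : EuclideanSpace ℝ (Fin n)) r))⁻¹ *
        ∫ w in symmDiff (ball 0 r) (ball z r), f (x + w) :=
        integral_mono_of_nonneg (Filter.Eventually.of_forall fun x => abs_nonneg _)
          (hint.const_mul _)
          (Filter.Eventually.of_forall fun x => abs_ballAvg_sub_le hf h0 h1 r x z)
    _ = (volume.real (ball (0 : EuclideanSpace ℝ (Fin n)) r))⁻¹ *
        (volume.real (symmDiff (ball 0 r) (ball z r)) * ∫ x in openCube n L, f x) := by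
        rw [integral_const_mul, heq]
    _ ≤ (volume.real (ball (0 : EuclideanSpace ℝ (Fin n)) r))⁻¹ *
        (2 * (n + 1) * (‖z‖ / r) * volume.real (ball (0 : EuclideanSpace ℝ (Fin n)) r) *
          ∫ x in openCube n L, f x) := by
        gcongr
        · exact integral_nonneg h0
        · exact volume_real_symmDiff_ball_le z hr
    _ = _ := by field_simp

end

/-- Lipschitz and `L¹`-modulus estimates for the concentration test function,
with a constant depending only on the dimension `n`. -/
theorem stmt3 (n : ℕ) :
    ∃ C : ℝ, 0 < C ∧
      ∀ (L ℓ r : ℝ), 0 < L → 0 < ℓ → ℓ ≤ r →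
      ∀ χ : EuclideanSpace ℝ (Fin n) → ℝ,
        LocallyIntegrable χ volume →
        (∀ x, 0 ≤ χ x) → (∀ x, χ x ≤ 1) →
        (∀ (k : Fin n → ℤ) (x : EuclideanSpace ℝ (Fin n)),
          χ (x + (EuclideanSpace.equiv (Fin n) ℝ).symm (fun i => L * (k i : ℝ))) = χ x) →
        (∀ x z : EuclideanSpace ℝ (Fin n),
          |psiFn χ ℓ r x - psiFn χ ℓ r (x + z)| ≤ C * ‖z‖ / r) ∧
        (∀ z : EuclideanSpace ℝ (Fin n),
          (∫ x in {x : EuclideanSpace ℝ (Fin n) | ∀ i, x i ∈ Ioo (0:ℝ) L},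
              |psiFn χ ℓ r x - psiFn χ ℓ r (x + z)|)
            ≤ C * (‖z‖ / r) * (2 * r / ℓ) ^ n *
              ∫ x in {x : EuclideanSpace ℝ (Fin n) | ∀ i, x i ∈ Ioo (0:ℝ) L}, χ x) := by
  refine ⟨2 * (n + 1), by positivity, ?_⟩
  intro L ℓ r hL hℓ hℓr χ hχ h0 h1 hper
  have hr : 0 < r := hℓ.trans_le hℓr
  have hp : CubePeriodic L χ := hper
  have hχm : AEStronglyMeasurable χ volume := hχ.aestronglyMeasurable
  have hcont := continuous_ballAvg hχm h0 h1 (r := 2 * r) (by positivity)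
  set c : ℝ := (2 * r / ℓ) ^ n with hc
  have hc0 : 0 ≤ c := by positivity
  set g : EuclideanSpace ℝ (Fin n) → ℝ := fun y => min (c * ballAvg χ (2 * r) y) 1 with hg
  have hψ : psiFn χ ℓ r = ballAvg g r := rfl
  have hg0 : ∀ x, 0 ≤ g x := fun x =>
    le_min (mul_nonneg hc0 (ballAvg_nonneg h0 _ _)) zero_le_one
  have hg1 : ∀ x, g x ≤ 1 := fun x => min_le_right _ _
  have hgm : AEStronglyMeasurable g volume :=
    ((continuous_const.mul hcont).min continuous_const).aestronglyMeasurable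
  have hgp : CubePeriodic L g := fun k x => by simp only [hg, hp.ballAvg (2 * r) k x]
  have hgint : ∫ x in openCube n L, g x ≤ c * ∫ x in openCube n L, χ x := by
    rw [← hp.setIntegral_ballAvg hL hχm h0 h1 (r := 2 * r) (by positivity),
      ← integral_const_mul]
    refine integral_mono_of_nonneg (Filter.Eventually.of_forall hg0) ?_
      (Filter.Eventually.of_forall fun x => min_le_left _ _)
    rw [funext (ballAvg_eq χ (2 * r))]
    refine Integrable.const_mul ?_ _
    exact (hp.setIntegral_setIntegral_translate hL hχm h0 h1 measure_ball_lt_top).1.const_mul _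
  rw [hψ]
  refine ⟨abs_ballAvg_sub_le_norm hgm hg0 hg1 hr, fun z => ?_⟩
  refine (hgp.setIntegral_abs_ballAvg_sub_le hL hgm hg0 hg1 hr z).trans ?_
  rw [mul_assoc _ c]
  exact mul_le_mul_of_nonneg_left hgint (by positivity)
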